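/- Let m be a positive integer, let 0 < r_1 ≤ r_2 ≤ ⋯ ≤ r_m be real numbers, and let θ be a positive integer. For each j = 1,…,m let θ^j be an integer with 0 ≤ θ^j ≤ θ, and let r_j^t > 0 (for 1 ≤ t ≤ θ^j) be positive real numbers such that ∑_{j=k}^m ∑_{t=1}^{θ^j} r_j^t ≥ θ·∑_{j=k}^m r_j for every k with 2 ≤ k ≤ m, and ∑_{j=1}^m ∑_{t=1}^{θ^j} r_j^t = θ·∑_{j=1}^m r_j. Then ∑_{j=1}^m ∑_{t=1}^{θ^j} (r_j^t)² ≥ θ·∑_{j=1}^m r_j², and equality holds if and only if θ^j = θ and r_j^t = r_j for all t = 1,…,θ and j = 1,…,m. -/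

import Mathlib

open Finset

/-- Summation by parts for a monotone weight and a sequence with nonnegative proper tail sums. -/
theorem mul_sum_Icc_le_sum_mul_of_tail_nonneg {m : ℕ} (r d : ℕ → ℝ)
    (hmono : ∀ j k, 1 ≤ j → j ≤ k → k ≤ m → r j ≤ r k)
    (htail : ∀ k, 2 ≤ k → k ≤ m → 0 ≤ ∑ j ∈ Icc k m, d j) {k : ℕ} (hk : 1 ≤ k) (hkm : k ≤ m) :
    r k * ∑ j ∈ Icc k m, d j ≤ ∑ j ∈ Icc k m, r j * d j := by
  induction hkm using Nat.decreasingInduction with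
  | self => simp
  | of_succ k hkm ih =>
    have hk1 := ih (by omega)
    have hmul := mul_le_mul_of_nonneg_right (hmono k (k + 1) hk (by omega) hkm)
      (htail (k + 1) (by omega) hkm)
    rw [← insert_Icc_add_one_left_eq_Icc hkm.le, sum_insert (by simp), sum_insert (by simp)]
    linarith

/-- Comparison of a row sum of squares with `θ * x ^ 2` when the row has `n` entries. -/
theorem sum_sq_eq_sum_sub_sq_add (θ n : ℕ) (x : ℝ) (b : ℕ → ℝ) :
    ∑ t ∈ Icc 1 n, b t ^ 2 = (∑ t ∈ Icc 1 n, (b t - x) ^ 2 + ((θ : ℝ) - n) * x ^ 2)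
      + 2 * (x * (∑ t ∈ Icc 1 n, b t - θ * x)) + θ * x ^ 2 := by
  have h : ∑ t ∈ Icc 1 n, (b t - x) ^ 2
      = ∑ t ∈ Icc 1 n, b t ^ 2 - 2 * x * ∑ t ∈ Icc 1 n, b t + n * x ^ 2 := by
    simp only [sub_sq, sum_add_distrib, sum_sub_distrib, mul_sum, sum_const, Nat.card_Icc,
      nsmul_eq_mul, Nat.add_sub_cancel]
    congr 2
    exact sum_congr rfl fun t _ => by ring
  rw [h]
  ring

/-- Lemma 4.4 (second part): the variant in which the zero entries among the `a j t` have
been removed, so that row `j` has `θj j ≤ θ` entries, all strictly positive.  The same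
inequality holds, with equality iff `θj j = θ` and `a j t = r j` for all `j, t`. -/
theorem lemma_4_4_part2 (m θ : ℕ) (hm : 0 < m) (hθ : 0 < θ)
    (r : ℕ → ℝ) (θj : ℕ → ℕ) (a : ℕ → ℕ → ℝ)
    (hpos : 0 < r 1)
    (hmono : ∀ j k, 1 ≤ j → j ≤ k → k ≤ m → r j ≤ r k)
    (hθj : ∀ j ∈ Icc 1 m, θj j ≤ θ)
    (hapos : ∀ j ∈ Icc 1 m, ∀ t ∈ Icc 1 (θj j), 0 < a j t)
    (htail : ∀ k, 2 ≤ k → k ≤ m →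
      ∑ j ∈ Icc k m, ∑ t ∈ Icc 1 (θj j), a j t ≥ (θ : ℝ) * ∑ j ∈ Icc k m, r j)
    (htotal : ∑ j ∈ Icc 1 m, ∑ t ∈ Icc 1 (θj j), a j t = (θ : ℝ) * ∑ j ∈ Icc 1 m, r j) :
    (∑ j ∈ Icc 1 m, ∑ t ∈ Icc 1 (θj j), (a j t) ^ 2 ≥ (θ : ℝ) * ∑ j ∈ Icc 1 m, (r j) ^ 2) ∧
    ((∑ j ∈ Icc 1 m, ∑ t ∈ Icc 1 (θj j), (a j t) ^ 2
        = (θ : ℝ) * ∑ j ∈ Icc 1 m, (r j) ^ 2) ↔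
      (∀ j ∈ Icc 1 m, θj j = θ) ∧ ∀ j ∈ Icc 1 m, ∀ t ∈ Icc 1 θ, a j t = r j) := by
  set d : ℕ → ℝ := fun j => ∑ t ∈ Icc 1 (θj j), a j t - θ * r j with hd
  let e : ℕ → ℝ := fun j => ∑ t ∈ Icc 1 (θj j), (a j t - r j) ^ 2 + ((θ : ℝ) - θj j) * r j ^ 2
  have hdecomp : ∑ j ∈ Icc 1 m, ∑ t ∈ Icc 1 (θj j), (a j t) ^ 2
      = ∑ j ∈ Icc 1 m, e j + 2 * ∑ j ∈ Icc 1 m, r j * d j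
        + (θ : ℝ) * ∑ j ∈ Icc 1 m, (r j) ^ 2 := by
    simp only [mul_sum, ← sum_add_distrib]
    exact sum_congr rfl fun j _ => sum_sq_eq_sum_sub_sq_add θ (θj j) (r j) (a j)
  have hsum : ∀ k, ∑ j ∈ Icc k m, d j
      = ∑ j ∈ Icc k m, ∑ t ∈ Icc 1 (θj j), a j t - (θ : ℝ) * ∑ j ∈ Icc k m, r j := fun k => by
    simp only [hd, sum_sub_distrib, mul_sum]
  have hweighted : 0 ≤ ∑ j ∈ Icc 1 m, r j * d j := by
    have h := mul_sum_Icc_le_sum_mul_of_tail_nonneg r d hmono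
      (fun k h2 hkm => by rw [hsum]; linarith [htail k h2 hkm]) le_rfl hm
    rwa [hsum, htotal, sub_self, mul_zero] at h
  have hdef : ∀ j ∈ Icc 1 m, 0 ≤ ((θ : ℝ) - θj j) * r j ^ 2 := fun j hj =>
    mul_nonneg (sub_nonneg.2 (by exact_mod_cast hθj j hj)) (sq_nonneg _)
  have hsq : ∀ j, 0 ≤ ∑ t ∈ Icc 1 (θj j), (a j t - r j) ^ 2 := fun j =>
    sum_nonneg fun t _ => sq_nonneg _
  have he_nonneg : ∀ j ∈ Icc 1 m, 0 ≤ e j := fun j hj => add_nonneg (hsq j) (hdef j hj)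
  have hesum := sum_nonneg he_nonneg
  refine ⟨by linarith, fun heq => ?_, fun ⟨hrow, hentry⟩ => ?_⟩
  · have hzero := (sum_eq_zero_iff_of_nonneg he_nonneg).1 (by linarith)
    have hfull : ∀ j ∈ Icc 1 m, θj j = θ := fun j hj => by
      have hr : 0 < r j := hpos.trans_le
        (hmono 1 j le_rfl (mem_Icc.1 hj).1 (mem_Icc.1 hj).2)
      have h : ((θ : ℝ) - θj j) * r j ^ 2 = 0 :=
        ((add_eq_zero_iff_of_nonneg (hsq j) (hdef j hj)).1 (hzero j hj)).2
      have h' := (mul_eq_zero.1 h).resolve_right (pow_pos hr 2).ne'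
      exact_mod_cast (sub_eq_zero.1 h').symm
    refine ⟨hfull, fun j hj t ht => ?_⟩
    have h := ((add_eq_zero_iff_of_nonneg (hsq j) (hdef j hj)).1 (hzero j hj)).1
    rw [← hfull j hj] at ht
    have h' := (sum_eq_zero_iff_of_nonneg fun t _ => sq_nonneg _).1 h t ht
    exact sub_eq_zero.1 (pow_eq_zero_iff two_ne_zero |>.1 h')
  · rw [mul_sum]
    refine sum_congr rfl fun j hj => ?_
    rw [hrow j hj, sum_congr rfl fun t ht => by rw [hentry j hj t ht]]
    simp
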